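/- For all real ν ≥ 0 and all x > 0, I_ν(x)·K_ν(x) > 1/(2√(x² + ν² + 1/3)). -/

import Mathlib

open Real

/-- Modified Bessel function of the first kind `I_ν(x)` (for `x > 0`),
defined by its standard power series. -/
noncomputable def besselI (ν x : ℝ) : ℝ :=
  ∑' k : ℕ, (x / 2) ^ (2 * k) / ((Nat.factorial k : ℝ) * Real.Gamma (k + ν + 1)) * (x / 2) ^ ν

/-- Modified Bessel function of the second kind `K_ν(x)` (for `x > 0`),
defined by its standard integral representation. -/
noncomputable def besselK (ν x : ℝ) : ℝ :=
  ∫ t in Set.Ioi (0 : ℝ), Real.exp (-x * Real.cosh t) * Real.cosh (ν * t)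

open Set Filter Topology MeasureTheory

/-- A function with `d'' < 0` whenever `d ≤ 0`, `d' ≤ 0` keeps decreasing to the right. -/
lemma right_contra (d d1 d2 : ℝ → ℝ) (h1 : ∀ s, HasDerivAt d (d1 s) s)
    (h2 : ∀ s, HasDerivAt d1 (d2 s) s) (hneg : ∀ s, d s ≤ 0 → d2 s < 0)
    (C : ℝ) (hC : ∀ s, C ≤ d s) (s0 : ℝ) (hd : d s0 ≤ 0) (hd1 : d1 s0 ≤ 0) : False := by
  have cd : Continuous d := continuous_iff_continuousAt.2 fun s => (h1 s).continuousAt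
  have cd1 : Continuous d1 := continuous_iff_continuousAt.2 fun s => (h2 s).continuousAt
  have anti1 : ∀ a b : ℝ, (∀ x ∈ Ioo a b, d1 x ≤ 0) → AntitoneOn d (Icc a b) := by
    intro a b h
    refine antitoneOn_of_deriv_nonpos (convex_Icc a b) cd.continuousOn
      (fun x _ => (h1 x).differentiableAt.differentiableWithinAt) ?_
    intro x hx
    rw [interior_Icc] at hx
    rw [(h1 x).deriv]; exact h x hx
  have key : ∀ b, Icc s0 b ⊆ {s | d1 s ≤ 0 ∧ d s ≤ 0} := by
    intro b
    refine IsClosed.Icc_subset_of_forall_exists_gt ?_ ⟨hd1, hd⟩ ?_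
    · exact IsClosed.inter ((isClosed_le cd1 continuous_const).inter
        (isClosed_le cd continuous_const)) isClosed_Icc
    · rintro x ⟨⟨hx1, hx0⟩, -⟩ y hy
      have hlt := hneg x hx0
      have hs := (hasDerivAt_iff_tendsto_slope.1 (h2 x)).eventually (gt_mem_nhds hlt)
      have hs' : ∀ᶠ z in 𝓝[>] x, slope d1 x z < 0 :=
        hs.filter_mono (nhdsWithin_mono x (fun z hz => ne_of_gt hz))
      obtain ⟨u, hu, hsub⟩ := mem_nhdsGT_iff_exists_Ioo_subset.1 hs'
      have hux : x < u := hu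
      have hyx : x < y := hy
      have hd1neg : ∀ z ∈ Ioo x u, d1 z ≤ 0 := by
        intro z hz
        have h3 : slope d1 x z < 0 := hsub hz
        rw [slope_def_field] at h3
        have hzx : 0 < z - x := sub_pos.2 hz.1
        have := (div_lt_iff₀ hzx).1 h3
        linarith
      obtain ⟨z, hxz, hz⟩ := exists_between (lt_min hux hyx)
      have hzu : z < u := lt_of_lt_of_le hz (min_le_left _ _)
      have hzy : z < y := lt_of_lt_of_le hz (min_le_right _ _)
      refine ⟨z, ⟨hd1neg z ⟨hxz, hzu⟩, ?_⟩, hxz, hzy.le⟩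
      have := anti1 x z (fun w hw => hd1neg w ⟨hw.1, hw.2.trans hzu⟩)
        (left_mem_Icc.2 hxz.le) (right_mem_Icc.2 hxz.le) hxz.le
      linarith
  have key' : ∀ s, s0 ≤ s → d1 s ≤ 0 ∧ d s ≤ 0 := fun s hs => key s ⟨hs, le_rfl⟩
  have sa : StrictAntiOn d1 (Ici s0) := by
    refine strictAntiOn_of_deriv_neg (convex_Ici s0) cd1.continuousOn ?_
    intro x hx
    rw [interior_Ici] at hx
    rw [(h2 x).deriv]
    exact hneg x (key' x (le_of_lt hx)).2
  have hm : d1 (s0 + 1) < 0 :=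
    lt_of_lt_of_le (sa self_mem_Ici (mem_Ici.2 (by linarith)) (by linarith)) hd1
  have hlin : ∀ y, s0 + 1 ≤ y → d y - d (s0 + 1) ≤ d1 (s0 + 1) * (y - (s0 + 1)) := by
    intro y hy
    refine (convex_Ici (s0 + 1)).image_sub_le_mul_sub_of_deriv_le cd.continuousOn
      (fun x _ => (h1 x).differentiableAt.differentiableWithinAt) ?_ _ self_mem_Ici _ hy hy
    intro x hx
    rw [interior_Ici] at hx
    rw [(h1 x).deriv]
    have hx' : s0 + 1 < x := hx
    exact (sa (mem_Ici.2 (by linarith)) (mem_Ici.2 (by linarith)) hx').le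
  have hA := key' (s0 + 1) (by linarith)
  have hCn := hC (s0 + 1)
  set m := d1 (s0 + 1) with hmdef
  have h3 := hlin (s0 + 1 + (C - 1) / m) (by
    have : 0 ≤ (C - 1) / m := div_nonneg_of_nonpos (by linarith) hm.le
    linarith)
  have h4 := hC (s0 + 1 + (C - 1) / m)
  have h5 : m * (s0 + 1 + (C - 1) / m - (s0 + 1)) = C - 1 := by
    rw [add_sub_cancel_left, mul_div_cancel₀ _ hm.ne]
  linarith

lemma pos_of_concave (d d1 d2 : ℝ → ℝ) (h1 : ∀ s, HasDerivAt d (d1 s) s)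
    (h2 : ∀ s, HasDerivAt d1 (d2 s) s) (hneg : ∀ s, d s ≤ 0 → d2 s < 0)
    (C : ℝ) (hC : ∀ s, C ≤ d s) (s0 : ℝ) : 0 < d s0 := by
  by_contra! hd
  rcases le_total (d1 s0) 0 with h | h
  · exact right_contra d d1 d2 h1 h2 hneg C hC s0 hd h
  · refine right_contra (fun s => d (-s)) (fun s => -d1 (-s)) (fun s => d2 (-s)) ?_ ?_
      (fun s => hneg (-s)) C (fun s => hC (-s)) (-s0) (by simpa using hd) (by simpa using h)
    · intro s
      have := (h1 (-s)).comp s (hasDerivAt_neg s)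
      simpa [Function.comp_def] using this
    · intro s
      have := ((h2 (-s)).comp s (hasDerivAt_neg s)).neg
      exact this.congr_deriv (by ring)

lemma sqrt_derivs (p p1 p2 : ℝ → ℝ) (hp : ∀ s, 0 < p s) (h1 : ∀ s, HasDerivAt p (p1 s) s)
    (h2 : ∀ s, HasDerivAt p1 (p2 s) s) :
    (∀ s, HasDerivAt (fun s => √(p s)) (p1 s / (2 * √(p s))) s) ∧
    (∀ s, HasDerivAt (fun s => p1 s / (2 * √(p s)))
      ((2 * p s * p2 s - p1 s ^ 2) / (4 * √(p s) ^ 3)) s) := by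
  have hA : ∀ s, HasDerivAt (fun s => √(p s)) (p1 s / (2 * √(p s))) s :=
    fun s => (h1 s).sqrt (hp s).ne'
  refine ⟨hA, fun s => ?_⟩
  have hr : 0 < √(p s) := Real.sqrt_pos.2 (hp s)
  have := (h2 s).div ((hA s).const_mul 2) (by positivity)
  refine this.congr_deriv ?_
  have hsq : p s = √(p s) ^ 2 := (Real.sq_sqrt (hp s).le).symm
  set r := √(p s)
  rw [hsq]
  field_simp
  ring

lemma comparison (p p1 p2 g g1 g2 q : ℝ → ℝ) (W : ℝ) (hW : 1 ≤ W) (hq : ∀ s, 0 ≤ q s)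
    (hp : ∀ s, 0 < p s) (hp1 : ∀ s, HasDerivAt p (p1 s) s)
    (hp2 : ∀ s, HasDerivAt p1 (p2 s) s) (hg : ∀ s, 0 < g s)
    (hg1 : ∀ s, HasDerivAt g (g1 s) s)
    (hg2 : ∀ s, HasDerivAt g1 (g2 s) s)
    (hpe : ∀ s, 2 * p s * p2 s - p1 s ^ 2 = 4 * q s * p s ^ 2 - W ^ 2)
    (hge : ∀ s, 4 * q s * g s ^ 2 - 1 < 2 * g s * g2 s - g1 s ^ 2)
    (B : ℝ) (hB : ∀ s, g s ≤ B) (s : ℝ) : g s < p s := by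
  obtain ⟨a1, a2⟩ := sqrt_derivs p p1 p2 hp hp1 hp2
  obtain ⟨b1, b2⟩ := sqrt_derivs g g1 g2 hg hg1 hg2
  have := pos_of_concave _ _ _ (fun s => (a1 s).sub (b1 s)) (fun s => (a2 s).sub (b2 s)) ?_
    (-√B) ?_ s
  · exact (Real.sqrt_lt_sqrt_iff (hg s).le).1 (sub_pos.1 this)
  · intro s hs
    simp only [Pi.sub_apply] at hs
    have hr : 0 < √(p s) := Real.sqrt_pos.2 (hp s)
    have hR : 0 < √(g s) := Real.sqrt_pos.2 (hg s)
    have h1 : p s = √(p s) ^ 2 := (Real.sq_sqrt (hp s).le).symm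
    have h2 : g s = √(g s) ^ 2 := (Real.sq_sqrt (hg s).le).symm
    have e1 := hpe s
    have e2 := hge s
    set r := √(p s)
    set R := √(g s)
    have hrR : r ≤ R := by linarith
    have hrR3 : r ^ 3 ≤ R ^ 3 := by gcongr
    have A : (2 * p s * p2 s - p1 s ^ 2) / (4 * r ^ 3) = q s * r - W ^ 2 / (4 * r ^ 3) := by
      rw [e1, h1]; field_simp
    have Bb : q s * R - 1 / (4 * R ^ 3) < (2 * g s * g2 s - g1 s ^ 2) / (4 * R ^ 3) := by
      rw [lt_div_iff₀ (by positivity)]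
      refine lt_of_eq_of_lt ?_ e2
      rw [h2]; field_simp
    have h3 : q s * r ≤ q s * R := mul_le_mul_of_nonneg_left hrR (hq s)
    have h4 : 1 / (4 * R ^ 3) ≤ W ^ 2 / (4 * r ^ 3) := by
      apply div_le_div₀ (by positivity) (by nlinarith) (by positivity) (by linarith)
    rw [A]
    linarith
  · intro s
    simp only [Pi.sub_apply]
    have := Real.sqrt_le_sqrt (hB s)
    have := Real.sqrt_nonneg (p s)
    linarith

lemma g_bound (ν : ℝ) (p p1 p2 : ℝ → ℝ) (W : ℝ) (hW : 1 ≤ W)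
    (hp : ∀ s, 0 < p s) (hp1 : ∀ s, HasDerivAt p (p1 s) s)
    (hp2 : ∀ s, HasDerivAt p1 (p2 s) s)
    (hpe : ∀ s, 2 * p s * p2 s - p1 s ^ 2 = 4 * (Real.exp s ^ 2 + ν ^ 2) * p s ^ 2 - W ^ 2)
    (s : ℝ) : 1 / (2 * √(Real.exp s ^ 2 + ν ^ 2 + 1 / 3)) < p s := by
  have hQpos : ∀ s, 0 < Real.exp s ^ 2 + ν ^ 2 + 1 / 3 := fun s => by positivity
  have hQ : ∀ s, HasDerivAt (fun s => Real.exp s ^ 2 + ν ^ 2 + 1 / 3) (2 * Real.exp s ^ 2) s := by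
    intro s
    have := (((Real.hasDerivAt_exp s).pow 2).add_const (ν ^ 2)).add_const (1 / 3)
    refine this.congr_deriv ?_
    simp; ring
  have hR : ∀ s, HasDerivAt (fun s => √(Real.exp s ^ 2 + ν ^ 2 + 1 / 3))
      (2 * Real.exp s ^ 2 / (2 * √(Real.exp s ^ 2 + ν ^ 2 + 1 / 3))) s :=
    fun s => (hQ s).sqrt (hQpos s).ne'
  refine comparison p p1 p2 (fun s => 1 / (2 * √(Real.exp s ^ 2 + ν ^ 2 + 1 / 3)))
    (fun s => - Real.exp s ^ 2 / (2 * √(Real.exp s ^ 2 + ν ^ 2 + 1 / 3) ^ 3))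
    (fun s => - Real.exp s ^ 2 / √(Real.exp s ^ 2 + ν ^ 2 + 1 / 3) ^ 3
      + 3 / 2 * Real.exp s ^ 4 / √(Real.exp s ^ 2 + ν ^ 2 + 1 / 3) ^ 5)
    (fun s => Real.exp s ^ 2 + ν ^ 2) W hW (fun s => by positivity) hp hp1 hp2 ?_ ?_ ?_ hpe ?_
    (1 / (2 * √(1 / 3))) ?_ s
  · intro s; have := hQpos s; positivity
  · intro s
    have hr : 0 < √(Real.exp s ^ 2 + ν ^ 2 + 1 / 3) := Real.sqrt_pos.2 (hQpos s)
    have := (hasDerivAt_const s (1 : ℝ)).div ((hR s).const_mul 2) (by positivity)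
    refine this.congr_deriv ?_
    field_simp
    ring
  · intro s
    have hr : 0 < √(Real.exp s ^ 2 + ν ^ 2 + 1 / 3) := Real.sqrt_pos.2 (hQpos s)
    have := ((Real.hasDerivAt_exp s).pow 2).neg.div (((hR s).pow 3).const_mul 2)
      (by simp only [Pi.pow_apply]; positivity)
    refine this.congr_deriv ?_
    simp only [Pi.pow_apply, Pi.neg_apply]
    field_simp
    push_cast
    ring
  · intro s
    have hr : 0 < √(Real.exp s ^ 2 + ν ^ 2 + 1 / 3) := Real.sqrt_pos.2 (hQpos s)
    have hsq := Real.sq_sqrt (hQpos s).le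
    have hx := Real.exp_pos s
    set r := √(Real.exp s ^ 2 + ν ^ 2 + 1 / 3)
    set x := Real.exp s
    have hq : x ^ 2 + ν ^ 2 = r ^ 2 - 1 / 3 := by linarith
    rw [hq, ← sub_pos]
    have : 2 * (1 / (2 * r)) * (-x ^ 2 / r ^ 3 + 3 / 2 * x ^ 4 / r ^ 5) - (-x ^ 2 / (2 * r ^ 3)) ^ 2
        - (4 * (r ^ 2 - 1 / 3) * (1 / (2 * r)) ^ 2 - 1)
        = (1 / 3 * (r ^ 2) ^ 2 - x ^ 2 * r ^ 2 + 5 / 4 * (x ^ 2) ^ 2) / r ^ 6 := by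
      field_simp
      ring
    rw [this]
    apply div_pos _ (by positivity)
    have : 0 < (r ^ 2) ^ 2 := by positivity
    nlinarith [sq_nonneg (5 * x ^ 2 - 2 * r ^ 2)]
  · intro s
    gcongr
    have := sq_nonneg (Real.exp s)
    have := sq_nonneg ν
    linarith

/-- General estimate used for all integrands. -/
lemma exp_cosh_bound (c a t : ℝ) (hc : 0 < c) (ht : 0 ≤ t) :
    Real.exp (a * t) * Real.exp (-c * Real.cosh t)
      ≤ Real.exp ((a + 1) ^ 2 / c) * Real.exp (-t) := by
  rw [← Real.exp_add, ← Real.exp_add, Real.exp_le_exp]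
  have h1 : t ^ 2 / 4 ≤ Real.cosh t := by
    have := Real.quadratic_le_exp_of_nonneg ht
    have h2 := Real.exp_pos (-t)
    rw [Real.cosh_eq]
    linarith
  have h2 : c * (t ^ 2 / 4) ≤ c * Real.cosh t := mul_le_mul_of_nonneg_left h1 hc.le
  have h3 : (a + 1) * t - c * (t ^ 2 / 4) ≤ (a + 1) ^ 2 / c := by
    rw [le_div_iff₀ hc]
    nlinarith [sq_nonneg (c * t / 2 - (a + 1))]
  linarith

lemma f_bound (f : ℝ → ℝ) (a B c : ℝ) (hc : 0 < c)
    (hf : ∀ t, 0 ≤ t → |f t| ≤ B * Real.exp (a * t)) (t : ℝ) (ht : 0 ≤ t) :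
    |f t * Real.exp (-c * Real.cosh t)| ≤ B * Real.exp ((a + 1) ^ 2 / c) * Real.exp (-t) := by
  have hB : 0 ≤ B := by
    have := (abs_nonneg _).trans (hf 0 le_rfl)
    simpa using this
  rw [abs_mul, abs_of_pos (Real.exp_pos _)]
  calc |f t| * Real.exp (-c * Real.cosh t)
      ≤ B * Real.exp (a * t) * Real.exp (-c * Real.cosh t) := by
        gcongr; exact hf t ht
    _ ≤ B * (Real.exp ((a + 1) ^ 2 / c) * Real.exp (-t)) := by
        rw [mul_assoc]
        exact mul_le_mul_of_nonneg_left (exp_cosh_bound c a t hc ht) hB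
    _ = _ := by ring

lemma f_integrable (f : ℝ → ℝ) (hfc : Continuous f) (a B c : ℝ) (hc : 0 < c)
    (hf : ∀ t, 0 ≤ t → |f t| ≤ B * Real.exp (a * t)) :
    IntegrableOn (fun t => f t * Real.exp (-c * Real.cosh t)) (Ioi 0) := by
  refine Integrable.mono' ((integrableOn_exp_neg_Ioi 0).const_mul
    (B * Real.exp ((a + 1) ^ 2 / c))) ?_ ?_
  · exact (by fun_prop : Continuous fun t => f t * Real.exp (-c * Real.cosh t)).aestronglyMeasurable
  · refine (ae_restrict_mem measurableSet_Ioi).mono fun t ht => ?_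
    exact f_bound f a B c hc hf t (le_of_lt ht)

lemma f_tendsto (f : ℝ → ℝ) (a B c : ℝ) (hc : 0 < c)
    (hf : ∀ t, 0 ≤ t → |f t| ≤ B * Real.exp (a * t)) :
    Tendsto (fun t => f t * Real.exp (-c * Real.cosh t)) atTop (𝓝 0) := by
  have h0 : Tendsto (fun t : ℝ => B * Real.exp ((a + 1) ^ 2 / c) * Real.exp (-t)) atTop (𝓝 0) := by
    simpa using (Real.tendsto_exp_neg_atTop_nhds_zero).const_mul (B * Real.exp ((a + 1) ^ 2 / c))
  refine squeeze_zero_norm' ?_ h0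
  filter_upwards [eventually_ge_atTop 0] with t ht
  exact f_bound f a B c hc hf t ht

lemma cosh_le_exp_mul (ν t : ℝ) (hν : 0 ≤ ν) (ht : 0 ≤ t) : |Real.cosh (ν * t)| ≤ Real.exp (ν * t) := by
  rw [abs_of_pos (Real.cosh_pos _), Real.cosh_eq]
  have h : 0 ≤ ν * t := mul_nonneg hν ht
  have : Real.exp (-(ν * t)) ≤ Real.exp (ν * t) := Real.exp_le_exp.2 (by linarith)
  linarith

lemma sinh_le_exp_mul (ν t : ℝ) (hν : 0 ≤ ν) (ht : 0 ≤ t) : |Real.sinh (ν * t)| ≤ Real.exp (ν * t) := by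
  have h : 0 ≤ ν * t := mul_nonneg hν ht
  rw [abs_of_nonneg (Real.sinh_nonneg_iff.2 h), Real.sinh_eq]
  have := Real.exp_pos (-(ν * t))
  have := Real.exp_pos (ν * t)
  linarith

lemma cosh_le_exp' (t : ℝ) (ht : 0 ≤ t) : |Real.cosh t| ≤ Real.exp t := by
  simpa using cosh_le_exp_mul 1 t zero_le_one ht

lemma sinh_le_exp' (t : ℝ) (ht : 0 ≤ t) : |Real.sinh t| ≤ Real.exp t := by
  simpa using sinh_le_exp_mul 1 t zero_le_one ht

/-- Weighted integrals. -/
noncomputable def MK (ν : ℝ) (j : ℕ) (x : ℝ) : ℝ :=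
  ∫ t in Ioi (0 : ℝ), Real.cosh t ^ j * Real.cosh (ν * t) * Real.exp (-x * Real.cosh t)

lemma coshj_bound (ν : ℝ) (hν : 0 ≤ ν) (j : ℕ) (t : ℝ) (ht : 0 ≤ t) :
    |Real.cosh t ^ j * Real.cosh (ν * t)| ≤ 1 * Real.exp ((j + ν) * t) := by
  rw [abs_mul, abs_pow, one_mul, add_mul, Real.exp_add, Real.exp_nat_mul]
  gcongr
  · exact cosh_le_exp' t ht
  · exact cosh_le_exp_mul ν t hν ht

lemma MK_integrable (ν : ℝ) (hν : 0 ≤ ν) (j : ℕ) (x : ℝ) (hx : 0 < x) :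
    IntegrableOn (fun t => Real.cosh t ^ j * Real.cosh (ν * t) * Real.exp (-x * Real.cosh t))
      (Ioi 0) :=
  f_integrable (fun t => Real.cosh t ^ j * Real.cosh (ν * t)) (by fun_prop) (j + ν) 1 x hx
    (coshj_bound ν hν j)

lemma MK_hasDerivAt (ν : ℝ) (hν : 0 ≤ ν) (j : ℕ) (x : ℝ) (hx : 0 < x) :
    HasDerivAt (MK ν j) (-MK ν (j + 1) x) x := by
  have := (hasDerivAt_integral_of_dominated_loc_of_deriv_le (μ := volume.restrict (Ioi (0 : ℝ)))
    (F := fun x t => Real.cosh t ^ j * Real.cosh (ν * t) * Real.exp (-x * Real.cosh t))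
    (F' := fun x t => -(Real.cosh t ^ (j + 1) * Real.cosh (ν * t) * Real.exp (-x * Real.cosh t)))
    (bound := fun t => Real.cosh t ^ (j + 1) * Real.cosh (ν * t) * Real.exp (-(x / 2) * Real.cosh t))
    (x₀ := x) (s := Ioi (x / 2)) (Ioi_mem_nhds (by linarith)) ?_ (MK_integrable ν hν j x hx)
    ?_ ?_ (MK_integrable ν hν (j + 1) (x / 2) (by linarith)) ?_).2
  · unfold MK
    refine this.congr_deriv ?_
    rw [integral_neg]
  · refine Eventually.of_forall fun y => ?_
    exact (by fun_prop : Continuous fun t =>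
      Real.cosh t ^ j * Real.cosh (ν * t) * Real.exp (-y * Real.cosh t)).aestronglyMeasurable
  · exact (by fun_prop : Continuous fun t => -(Real.cosh t ^ (j + 1) * Real.cosh (ν * t) *
      Real.exp (-x * Real.cosh t))).aestronglyMeasurable
  · refine Eventually.of_forall fun t y hy => ?_
    have h1 := Real.cosh_pos t
    have h2 := Real.cosh_pos (ν * t)
    have hy' : x / 2 < y := hy
    rw [norm_neg, Real.norm_of_nonneg (by positivity)]
    gcongr
  · refine Eventually.of_forall fun t y hy => ?_
    have h1 : HasDerivAt (fun y : ℝ => -y * Real.cosh t) (-1 * Real.cosh t) y :=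
      (hasDerivAt_neg y).mul_const _
    refine (h1.exp.const_mul (Real.cosh t ^ j * Real.cosh (ν * t))).congr_deriv ?_
    ring

lemma E_deriv (x t : ℝ) : HasDerivAt (fun t => Real.exp (-x * Real.cosh t))
    (-x * Real.sinh t * Real.exp (-x * Real.cosh t)) t := by
  refine (((Real.hasDerivAt_cosh t).const_mul (-x)).exp).congr_deriv ?_
  ring

lemma cosh_mul_deriv (ν t : ℝ) : HasDerivAt (fun t => Real.cosh (ν * t))
    (ν * Real.sinh (ν * t)) t := by
  have := ((hasDerivAt_id t).const_mul ν).cosh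
  refine this.congr_deriv ?_
  simp; ring

lemma sinh_mul_deriv (ν t : ℝ) : HasDerivAt (fun t => Real.sinh (ν * t))
    (ν * Real.cosh (ν * t)) t := by
  have := ((hasDerivAt_id t).const_mul ν).sinh
  refine this.congr_deriv ?_
  simp; ring

lemma MK_ode (ν : ℝ) (hν : 0 ≤ ν) (x : ℝ) (hx : 0 < x) :
    x ^ 2 * MK ν 2 x - x * MK ν 1 x = (x ^ 2 + ν ^ 2) * MK ν 0 x := by
  have i0 := MK_integrable ν hν 0 x hx
  have i1 := MK_integrable ν hν 1 x hx
  have i2 := MK_integrable ν hν 2 x hx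
  have hi := ((i2.const_mul (x ^ 2)).sub (i1.const_mul x)).sub (i0.const_mul (x ^ 2 + ν ^ 2))
  have key := integral_Ioi_of_hasDerivAt_of_tendsto (a := 0) (m := 0)
    (f := fun t => (-x * Real.sinh t * Real.cosh (ν * t) - ν * Real.sinh (ν * t))
      * Real.exp (-x * Real.cosh t)) ?_ ?_ hi ?_
  · rw [integral_sub' ((i2.const_mul (x ^ 2)).sub (i1.const_mul x)) (i0.const_mul (x ^ 2 + ν ^ 2)),
      integral_sub' (i2.const_mul (x ^ 2)) (i1.const_mul x), integral_const_mul, integral_const_mul,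
      integral_const_mul] at key
    unfold MK
    simp only [Real.sinh_zero, mul_zero, zero_mul, sub_zero] at key
    linarith
  · exact (by fun_prop : Continuous _).continuousWithinAt
  · intro t _
    have := ((((Real.hasDerivAt_sinh t).const_mul (-x)).mul (cosh_mul_deriv ν t)).sub
      ((sinh_mul_deriv ν t).const_mul ν)).mul (E_deriv x t)
    refine this.congr_deriv ?_
    have hs : Real.cosh t ^ 2 = 1 + Real.sinh t ^ 2 := by
      have := Real.cosh_sq t; linarith
    simp only [Pi.sub_apply, Pi.mul_apply, hs]
    ring
  · refine f_tendsto _ (1 + ν) (x + ν) x hx ?_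
    intro t ht
    have h1 := sinh_le_exp' t ht
    have h2 := cosh_le_exp_mul ν t hν ht
    have h3 := sinh_le_exp_mul ν t hν ht
    have he : 1 ≤ Real.exp t := Real.one_le_exp ht
    rw [add_mul 1 ν t, one_mul, Real.exp_add]
    calc |-x * Real.sinh t * Real.cosh (ν * t) - ν * Real.sinh (ν * t)|
        ≤ |-x * Real.sinh t * Real.cosh (ν * t)| + |ν * Real.sinh (ν * t)| := abs_sub _ _
      _ = x * (|Real.sinh t| * |Real.cosh (ν * t)|) + ν * |Real.sinh (ν * t)| := by
          rw [abs_mul, abs_mul, abs_mul, abs_neg, abs_of_pos hx, abs_of_nonneg hν, mul_assoc]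
      _ ≤ x * (Real.exp t * Real.exp (ν * t)) + ν * (Real.exp t * Real.exp (ν * t)) := by
          gcongr
          calc _ ≤ 1 * Real.exp (ν * t) := by linarith
            _ ≤ _ := by gcongr
      _ = _ := by ring

lemma MK_recur (ν : ℝ) (hν : 0 ≤ ν) (x : ℝ) (hx : 0 < x) :
    ν * MK ν 0 x + x * MK ν 1 x = x * MK (ν + 1) 0 x := by
  have i0 := MK_integrable ν hν 0 x hx
  have i1 := MK_integrable ν hν 1 x hx
  have i2 := MK_integrable (ν + 1) (by linarith) 0 x hx
  have hi := ((i0.const_mul ν).add (i1.const_mul x)).sub (i2.const_mul x)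
  have key := integral_Ioi_of_hasDerivAt_of_tendsto (a := 0) (m := 0)
    (f := fun t => Real.sinh (ν * t) * Real.exp (-x * Real.cosh t)) ?_ ?_ hi ?_
  · rw [integral_sub' ((i0.const_mul ν).add (i1.const_mul x)) (i2.const_mul x),
      integral_add' (i0.const_mul ν) (i1.const_mul x), integral_const_mul, integral_const_mul,
      integral_const_mul] at key
    unfold MK
    simp only [Real.sinh_zero, mul_zero, zero_mul, sub_zero] at key
    linarith
  · exact (by fun_prop : Continuous _).continuousWithinAt
  · intro t _
    refine ((sinh_mul_deriv ν t).mul (E_deriv x t)).congr_deriv ?_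
    simp only [Pi.sub_apply, Pi.add_apply]
    rw [add_mul ν 1 t, one_mul, Real.cosh_add]
    ring
  · refine f_tendsto _ ν 1 x hx ?_
    intro t ht
    rw [one_mul]
    exact sinh_le_exp_mul ν t hν ht

lemma MK_pos (ν : ℝ) (hν : 0 ≤ ν) (j : ℕ) (x : ℝ) (hx : 0 < x) : 0 < MK ν j x := by
  unfold MK
  have hpos : ∀ t, 0 < Real.cosh t ^ j * Real.cosh (ν * t) * Real.exp (-x * Real.cosh t) := by
    intro t
    have h1 := Real.cosh_pos t
    have h2 := Real.cosh_pos (ν * t)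
    positivity
  rw [setIntegral_pos_iff_support_of_nonneg_ae (Eventually.of_forall fun t => (hpos t).le)
    (MK_integrable ν hν j x hx)]
  have : Function.support (fun t => Real.cosh t ^ j * Real.cosh (ν * t) *
      Real.exp (-x * Real.cosh t)) = univ := by
    ext t; simpa using (hpos t).ne'
  rw [this]; simp

lemma MK_lower (μ : ℝ) (hμ : 1 ≤ μ) (x : ℝ) (hx : 0 < x) (hx2 : x ≤ 2) :
    1 / 2 * (2 / x) ^ μ * (Real.exp (-(x / 2)) * (Real.Gamma μ - x / 2)) ≤ MK μ 0 x := by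
  have hμ0 : 0 < μ := by linarith
  have hx0 : 0 < x / 2 := by linarith
  have hGi := Real.GammaIntegral_convergent hμ0
  have hGi2 : IntegrableOn (fun w => Real.exp (-w) * w ^ (μ - 1)) (Ioi (x / 2)) :=
    hGi.mono_set (Ioi_subset_Ioi hx0.le)
  have hG : Real.Gamma μ - x / 2 ≤ ∫ w in Ioi (x / 2), Real.exp (-w) * w ^ (μ - 1) := by
    rw [Real.Gamma_eq_integral hμ0, ← Ioc_union_Ioi_eq_Ioi hx0.le,
      setIntegral_union (Ioc_disjoint_Ioi le_rfl) measurableSet_Ioi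
        (hGi.mono_set Ioc_subset_Ioi_self) hGi2]
    have : ∫ w in Ioc 0 (x / 2), Real.exp (-w) * w ^ (μ - 1) ≤ ∫ w in Ioc 0 (x / 2), (1 : ℝ) := by
      refine setIntegral_mono_on (hGi.mono_set Ioc_subset_Ioi_self) (by simp) measurableSet_Ioc ?_
      intro w hw
      have h1 : Real.exp (-w) ≤ 1 := Real.exp_le_one_iff.2 (by linarith [hw.1])
      have h2 : w ^ (μ - 1) ≤ 1 := Real.rpow_le_one hw.1.le (by linarith [hw.2]) (by linarith)
      have h0 : 0 ≤ w ^ (μ - 1) := Real.rpow_nonneg hw.1.le _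
      calc _ ≤ (1 : ℝ) * 1 := by gcongr
        _ = 1 := one_mul 1
    have h3 : ∫ w in Ioc 0 (x / 2), (1 : ℝ) = x / 2 := by simp [hx0.le]
    linarith
  -- change of variables
  have hpt : ∀ t : ℝ, (Real.exp (-(x / 2 * Real.exp t)) * (x / 2 * Real.exp t) ^ (μ - 1)) *
      (x / 2 * Real.exp t) = (x / 2) ^ μ * (Real.exp (μ * t) * Real.exp (-(x / 2) * Real.exp t)) := by
    intro t
    have h1 : 0 < x / 2 * Real.exp t := by positivity
    rw [Real.rpow_sub_one h1.ne', mul_assoc, div_mul_cancel₀ _ h1.ne',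
      Real.mul_rpow hx0.le (Real.exp_pos t).le, ← Real.exp_mul, mul_comm t μ, neg_mul]
    ring
  have hle : ∀ t : ℝ, 0 ≤ t → Real.exp (-(x / 2)) * (Real.exp (μ * t) *
      Real.exp (-(x / 2) * Real.exp t)) / 2
      ≤ Real.cosh t ^ 0 * Real.cosh (μ * t) * Real.exp (-x * Real.cosh t) := by
    intro t ht
    have h1 : Real.exp (μ * t) / 2 ≤ Real.cosh (μ * t) := by
      rw [Real.cosh_eq]; have := Real.exp_pos (-(μ * t)); linarith
    have h2 : Real.exp (-(x / 2)) * Real.exp (-(x / 2) * Real.exp t)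
        ≤ Real.exp (-x * Real.cosh t) := by
      rw [← Real.exp_add, Real.exp_le_exp, Real.cosh_eq]
      have : Real.exp (-t) ≤ 1 := Real.exp_le_one_iff.2 (by linarith)
      nlinarith
    calc _ = Real.exp (μ * t) / 2 * (Real.exp (-(x / 2)) * Real.exp (-(x / 2) * Real.exp t)) := by
            ring
      _ ≤ Real.cosh (μ * t) * Real.exp (-x * Real.cosh t) := by
            have := Real.cosh_pos (μ * t)
            gcongr
      _ = _ := by ring
  have hcont : Continuous (fun t => Real.exp (μ * t) * Real.exp (-(x / 2) * Real.exp t)) := by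
    fun_prop
  have hint : IntegrableOn (fun t => Real.exp (μ * t) * Real.exp (-(x / 2) * Real.exp t))
      (Ioi 0) := by
    refine Integrable.mono' ((MK_integrable μ hμ0.le 0 x hx).const_mul (2 * Real.exp (x / 2)))
      hcont.aestronglyMeasurable ?_
    refine (ae_restrict_mem measurableSet_Ioi).mono fun t ht => ?_
    rw [Real.norm_of_nonneg (by positivity)]
    have := mul_le_mul_of_nonneg_left (hle t (le_of_lt ht))
      (by positivity : 0 ≤ 2 * Real.exp (x / 2))
    refine le_trans (le_of_eq ?_) this
    have h1 : Real.exp (x / 2) * Real.exp (-(x / 2)) = 1 := by rw [← Real.exp_add]; simp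
    linear_combination (-(Real.exp (μ * t) * Real.exp (-(x / 2) * Real.exp t))) * h1
  have hcv := integral_comp_mul_deriv_Ioi (a := 0) (f := fun t => x / 2 * Real.exp t)
    (f' := fun t => x / 2 * Real.exp t) (g := fun w => Real.exp (-w) * w ^ (μ - 1))
    (by fun_prop) (Real.tendsto_exp_atTop.const_mul_atTop hx0)
    (fun t _ => ((Real.hasDerivAt_exp t).const_mul _).hasDerivWithinAt) ?_ ?_ ?_
  · simp only [Function.comp_def, hpt, Real.exp_zero, mul_one] at hcv
    rw [integral_const_mul] at hcv
    have h5 : ∫ t in Ioi (0 : ℝ), Real.exp (-(x / 2)) * (Real.exp (μ * t) *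
        Real.exp (-(x / 2) * Real.exp t)) / 2 ≤ MK μ 0 x := by
      refine setIntegral_mono_on ((hint.const_mul _).div_const _) (MK_integrable μ hμ0.le 0 x hx)
        measurableSet_Ioi (fun t ht => hle t (le_of_lt ht))
    rw [integral_div, integral_const_mul] at h5
    refine le_trans ?_ h5
    rw [← hcv] at hG
    set J := ∫ t in Ioi (0 : ℝ), Real.exp (μ * t) * Real.exp (-(x / 2) * Real.exp t)
    have h6 : (2 / x) ^ μ * (x / 2) ^ μ = 1 := by
      rw [← Real.mul_rpow (by positivity) (by positivity)]
      have : 2 / x * (x / 2) = 1 := by field_simp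
      rw [this, Real.one_rpow]
    calc _ ≤ 1 / 2 * (2 / x) ^ μ * (Real.exp (-(x / 2)) * ((x / 2) ^ μ * J)) := by gcongr
      _ = Real.exp (-(x / 2)) * J / 2 * ((2 / x) ^ μ * (x / 2) ^ μ) := by ring
      _ = _ := by rw [h6, mul_one]
  · intro w hw
    obtain ⟨t, _, rfl⟩ := hw
    have h1 : 0 < x / 2 * Real.exp t := by positivity
    exact ((Real.continuous_exp.comp continuous_neg).continuousAt.mul
      (Real.continuousAt_rpow_const _ _ (Or.inl h1.ne'))).continuousWithinAt
  · refine hGi.mono_set ?_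
    rintro _ ⟨t, _, rfl⟩
    exact (by positivity : 0 < x / 2 * Real.exp t)
  · simp only [Function.comp_def, hpt]
    rw [integrableOn_Ici_iff_integrableOn_Ioi]
    exact hint.const_mul _

/-- Terms of the (differentiated) series for `I`, in the variable `s = log x`. -/
noncomputable def cI (ν : ℝ) (k : ℕ) : ℝ := 1 / ((Nat.factorial k : ℝ) * Real.Gamma (k + ν + 1))

noncomputable def tI (ν : ℝ) (j k : ℕ) (s : ℝ) : ℝ :=
  (2 * k + ν) ^ j * (cI ν k * Real.exp ((2 * k + ν) * (s - Real.log 2)))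

noncomputable def GI (ν : ℝ) (j : ℕ) (s : ℝ) : ℝ := ∑' k, tI ν j k s

lemma gamma_pos' (ν : ℝ) (hν : 0 ≤ ν) (k : ℕ) : 0 < Real.Gamma (k + ν + 1) :=
  Real.Gamma_pos_of_pos (by positivity)

lemma gamma_lower (ν : ℝ) (hν : 0 ≤ ν) (k : ℕ) : Real.Gamma (ν + 1) ≤ Real.Gamma (k + ν + 1) := by
  induction k with
  | zero => simp
  | succ k ih =>
    have h : Real.Gamma ((k + 1 : ℕ) + ν + 1) = (k + ν + 1) * Real.Gamma (k + ν + 1) := by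
      rw [← Real.Gamma_add_one (by positivity)]
      push_cast; ring_nf
    rw [h]
    have := gamma_pos' ν hν k
    have h0 : (0 : ℝ) ≤ k := Nat.cast_nonneg k
    nlinarith

lemma cI_pos (ν : ℝ) (hν : 0 ≤ ν) (k : ℕ) : 0 < cI ν k := by
  unfold cI
  have := gamma_pos' ν hν k
  positivity

lemma cI_le (ν : ℝ) (hν : 0 ≤ ν) (k : ℕ) :
    cI ν k ≤ 1 / Real.Gamma (ν + 1) * (1 / (Nat.factorial k : ℝ)) := by
  unfold cI
  have h1 : 0 < Real.Gamma (ν + 1) := Real.Gamma_pos_of_pos (by linarith)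
  have h2 := gamma_lower ν hν k
  have h3 : (0 : ℝ) < Nat.factorial k := by positivity
  rw [one_div_mul_one_div, mul_comm (Real.Gamma (ν + 1))]
  gcongr

lemma tI_nonneg (ν : ℝ) (hν : 0 ≤ ν) (j k : ℕ) (s : ℝ) : 0 ≤ tI ν j k s := by
  unfold tI
  have := cI_pos ν hν k
  positivity

lemma tI_mono (ν : ℝ) (hν : 0 ≤ ν) (j k : ℕ) (s S : ℝ) (h : s ≤ S) : tI ν j k s ≤ tI ν j k S := by
  unfold tI
  have := cI_pos ν hν k
  gcongr

lemma tI_summable (ν : ℝ) (hν : 0 ≤ ν) (j : ℕ) (s : ℝ) : Summable fun k => tI ν j k s := by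
  have h := (Real.summable_pow_div_factorial (Real.exp (2 * (s - Real.log 2 + 1)))).mul_left
    ((Nat.factorial j : ℝ) * (1 / Real.Gamma (ν + 1)) * Real.exp (ν * (s - Real.log 2 + 1)))
  refine Summable.of_nonneg_of_le (fun k => tI_nonneg ν hν j k s) (fun k => ?_) h
  unfold tI
  have h0 : (0 : ℝ) ≤ 2 * k + ν := by positivity
  have h1 : (2 * (k : ℝ) + ν) ^ j ≤ Nat.factorial j * Real.exp (2 * k + ν) := by
    have := Real.pow_div_factorial_le_exp (2 * k + ν) h0 j
    rw [div_le_iff₀ (by positivity)] at this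
    linarith
  have h2 := cI_le ν hν k
  have h3 := cI_pos ν hν k
  have h4 : 0 < Real.Gamma (ν + 1) := Real.Gamma_pos_of_pos (by linarith)
  calc (2 * (k : ℝ) + ν) ^ j * (cI ν k * Real.exp ((2 * k + ν) * (s - Real.log 2)))
      ≤ (Nat.factorial j * Real.exp (2 * k + ν)) * ((1 / Real.Gamma (ν + 1) *
        (1 / (Nat.factorial k : ℝ))) * Real.exp ((2 * k + ν) * (s - Real.log 2))) := by gcongr
    _ = _ := by
      have e : Real.exp (2 * k + ν) * Real.exp ((2 * k + ν) * (s - Real.log 2))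
          = Real.exp (ν * (s - Real.log 2 + 1)) * Real.exp (2 * (s - Real.log 2 + 1)) ^ k := by
        rw [← Real.exp_nat_mul, ← Real.exp_add, ← Real.exp_add]
        congr 1; ring
      linear_combination ((Nat.factorial j : ℝ) * (1 / Real.Gamma (ν + 1) *
        (1 / (Nat.factorial k : ℝ)))) * e

lemma GI_hasDerivAt (ν : ℝ) (hν : 0 ≤ ν) (j : ℕ) (s : ℝ) :
    HasDerivAt (GI ν j) (GI ν (j + 1) s) s := by
  unfold GI
  refine hasDerivAt_tsum_of_isPreconnected (t := Iio (s + 1)) (y₀ := s)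
    (tI_summable ν hν (j + 1) (s + 1)) isOpen_Iio isPreconnected_Iio ?_ ?_
    (mem_Iio.2 (by linarith)) (tI_summable ν hν j s) (mem_Iio.2 (by linarith))
  · intro k y _
    unfold tI
    have h1 : HasDerivAt (fun y : ℝ => (2 * k + ν) * (y - Real.log 2)) ((2 * k + ν) * 1) y :=
      ((hasDerivAt_id y).sub_const _).const_mul _
    refine ((h1.exp.const_mul (cI ν k)).const_mul ((2 * (k : ℝ) + ν) ^ j)).congr_deriv ?_
    ring
  · intro k y hy
    rw [Real.norm_of_nonneg (tI_nonneg ν hν _ k y)]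
    exact tI_mono ν hν _ k y _ (le_of_lt hy)

lemma cI_rec (ν : ℝ) (hν : 0 ≤ ν) (k : ℕ) :
    (k + 1) * (k + ν + 1) * cI ν (k + 1) = cI ν k := by
  unfold cI
  have h : Real.Gamma ((k + 1 : ℕ) + ν + 1) = (k + ν + 1) * Real.Gamma (k + ν + 1) := by
    rw [← Real.Gamma_add_one (by positivity)]
    push_cast; ring_nf
  have h1 := gamma_pos' ν hν k
  have h2 : (0 : ℝ) < k + ν + 1 := by positivity
  rw [h, Nat.factorial_succ]
  push_cast
  field_simp

lemma GI_ode (ν : ℝ) (hν : 0 ≤ ν) (s : ℝ) :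
    GI ν 2 s = (Real.exp s ^ 2 + ν ^ 2) * GI ν 0 s := by
  have s2 := tI_summable ν hν 2 s
  have s0 := tI_summable ν hν 0 s
  have hd : GI ν 2 s - ν ^ 2 * GI ν 0 s = ∑' k, (tI ν 2 k s - ν ^ 2 * tI ν 0 k s) := by
    unfold GI
    rw [s2.tsum_sub (s0.mul_left _), tsum_mul_left]
  have hd2 : ∑' k, (tI ν 2 k s - ν ^ 2 * tI ν 0 k s) = Real.exp s ^ 2 * GI ν 0 s := by
    rw [(s2.sub (s0.mul_left (ν ^ 2))).tsum_eq_zero_add]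
    unfold GI
    rw [← tsum_mul_left]
    have h0 : tI ν 2 0 s - ν ^ 2 * tI ν 0 0 s = 0 := by
      unfold tI; simp
    rw [h0, zero_add]
    congr 1
    ext k
    unfold tI
    rw [← cI_rec ν hν k]
    have e : Real.exp ((2 * ((k + 1 : ℕ) : ℝ) + ν) * (s - Real.log 2))
        = Real.exp s ^ 2 / 4 * Real.exp ((2 * k + ν) * (s - Real.log 2)) := by
      have e1 : (2 * ((k + 1 : ℕ) : ℝ) + ν) * (s - Real.log 2)
          = 2 * (s - Real.log 2) + (2 * k + ν) * (s - Real.log 2) := by push_cast; ring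
      rw [e1, Real.exp_add, two_mul, Real.exp_add, Real.exp_sub, Real.exp_log (by norm_num)]
      ring
    rw [e]
    push_cast
    ring
  linarith

lemma GI_pos (ν : ℝ) (hν : 0 ≤ ν) (s : ℝ) : 0 < GI ν 0 s := by
  refine (tI_summable ν hν 0 s).tsum_pos (fun k => tI_nonneg ν hν 0 k s) 0 ?_
  unfold tI
  have := cI_pos ν hν 0
  positivity

lemma GI_lower (ν : ℝ) (hν : 0 ≤ ν) (s : ℝ) :
    cI ν 0 * Real.exp (ν * (s - Real.log 2)) ≤ GI ν 0 s := by
  have := (tI_summable ν hν 0 s).le_tsum 0 (fun k _ => tI_nonneg ν hν 0 k s)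
  simpa [tI, GI] using this

lemma GI_one_ge (ν : ℝ) (hν : 0 ≤ ν) (s : ℝ) : ν * GI ν 0 s ≤ GI ν 1 s := by
  unfold GI
  rw [← tsum_mul_left]
  refine ((tI_summable ν hν 0 s).mul_left ν).tsum_le_tsum (fun k => ?_) (tI_summable ν hν 1 s)
  unfold tI
  have h := cI_pos ν hν k
  rw [pow_zero, pow_one, one_mul]
  gcongr
  have : (0 : ℝ) ≤ k := Nat.cast_nonneg k
  linarith

lemma besselI_eq (ν s : ℝ) : besselI ν (Real.exp s) = GI ν 0 s := by
  unfold besselI GI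
  congr 1
  ext k
  unfold tI cI
  have h : Real.exp s / 2 = Real.exp (s - Real.log 2) := by
    rw [Real.exp_sub, Real.exp_log (by norm_num)]
  rw [h, ← Real.exp_nat_mul, ← Real.exp_mul, add_mul, Real.exp_add, mul_comm ν]
  push_cast
  ring

lemma besselK_eq (ν x : ℝ) : besselK ν x = MK ν 0 x := by
  unfold besselK MK
  congr 1
  ext t
  ring

lemma wronskian_ge (ν : ℝ) (hν : 0 ≤ ν) (s : ℝ) (hs : Real.exp s ≤ 1) :
    Real.exp (-(Real.exp s / 2)) * (1 - Real.exp s / 2 / Real.Gamma (ν + 1)) ≤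
      MK ν 0 (Real.exp s) * GI ν 1 s + Real.exp s * MK ν 1 (Real.exp s) * GI ν 0 s := by
  have hx := Real.exp_pos s
  have hG : 0 < Real.Gamma (ν + 1) := Real.Gamma_pos_of_pos (by linarith)
  have k0 := MK_pos ν hν 0 _ hx
  have h1 := GI_one_ge ν hν s
  have h2 := GI_lower ν hν s
  have h3 := MK_recur ν hν _ hx
  have h4 := MK_lower (ν + 1) (by linarith) _ hx (by linarith)
  have k1 := MK_pos (ν + 1) (by linarith) 0 _ hx
  have e1 : Real.exp (ν * (s - Real.log 2)) = (Real.exp s / 2) ^ ν := by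
    have h : Real.exp s / 2 = Real.exp (s - Real.log 2) := by
      rw [Real.exp_sub, Real.exp_log (by norm_num)]
    rw [h, ← Real.exp_mul, mul_comm]
  have e2 : cI ν 0 = 1 / Real.Gamma (ν + 1) := by simp [cI]
  rw [e1, e2] at h2
  set x := Real.exp s
  have e3 : (x / 2) ^ ν * (2 / x) ^ (ν + 1) = 2 / x := by
    rw [Real.rpow_add_one (by positivity), ← mul_assoc, ← Real.mul_rpow (by positivity) (by positivity)]
    have : x / 2 * (2 / x) = 1 := by field_simp
    rw [this, Real.one_rpow, one_mul]
  calc _ = 1 / Real.Gamma (ν + 1) * (x / 2) ^ ν * (x * (1 / 2 * (2 / x) ^ (ν + 1) *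
          (Real.exp (-(x / 2)) * (Real.Gamma (ν + 1) - x / 2)))) := by
        have : 1 / Real.Gamma (ν + 1) * (x / 2) ^ ν * (x * (1 / 2 * (2 / x) ^ (ν + 1) *
          (Real.exp (-(x / 2)) * (Real.Gamma (ν + 1) - x / 2)))) =
          ((x / 2) ^ ν * (2 / x) ^ (ν + 1)) * (1 / Real.Gamma (ν + 1) * (x * (1 / 2 *
          (Real.exp (-(x / 2)) * (Real.Gamma (ν + 1) - x / 2))))) := by ring
        rw [this, e3]
        field_simp
    _ ≤ 1 / Real.Gamma (ν + 1) * (x / 2) ^ ν * (x * MK (ν + 1) 0 x) := by gcongr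
    _ ≤ GI ν 0 s * (x * MK (ν + 1) 0 x) := by gcongr
    _ = ν * GI ν 0 s * MK ν 0 x + x * MK ν 1 x * GI ν 0 s := by rw [← h3]; ring
    _ ≤ _ := by
      have := mul_le_mul_of_nonneg_left h1 k0.le
      linarith

lemma k0_deriv (ν : ℝ) (hν : 0 ≤ ν) (s : ℝ) :
    HasDerivAt (fun s => MK ν 0 (Real.exp s)) (-(Real.exp s * MK ν 1 (Real.exp s))) s := by
  refine ((MK_hasDerivAt ν hν 0 _ (Real.exp_pos s)).comp s (Real.hasDerivAt_exp s)).congr_deriv ?_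
  simp only [zero_add]; ring

lemma k1_deriv (ν : ℝ) (hν : 0 ≤ ν) (s : ℝ) :
    HasDerivAt (fun s => -(Real.exp s * MK ν 1 (Real.exp s)))
      ((Real.exp s ^ 2 + ν ^ 2) * MK ν 0 (Real.exp s)) s := by
  have h1 := (MK_hasDerivAt ν hν 1 _ (Real.exp_pos s)).comp s (Real.hasDerivAt_exp s)
  refine ((Real.hasDerivAt_exp s).mul h1).neg.congr_deriv ?_
  have := MK_ode ν hν _ (Real.exp_pos s)
  rw [← this]
  simp only [Function.comp_apply, Nat.reduceAdd]
  ring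

theorem besselI_mul_besselK_simple_lower_bound (ν x : ℝ) (hν : 0 ≤ ν) (hx : 0 < x) :
    besselI ν x * besselK ν x > 1 / (2 * Real.sqrt (x ^ 2 + ν ^ 2 + 1 / 3)) := by
  obtain ⟨s, rfl⟩ : ∃ s, x = Real.exp s := ⟨Real.log x, (Real.exp_log hx).symm⟩
  rw [besselI_eq, besselK_eq, gt_iff_lt]
  have a0 := GI_hasDerivAt ν hν 0
  have a1 : ∀ s, HasDerivAt (GI ν 1) ((Real.exp s ^ 2 + ν ^ 2) * GI ν 0 s) s := fun s =>
    (GI_hasDerivAt ν hν 1 s).congr_deriv (GI_ode ν hν s)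
  have b0 := k0_deriv ν hν
  have b1 := k1_deriv ν hν
  simp only [zero_add] at a0
  -- the Wronskian
  have hw : ∀ s, HasDerivAt (fun s => MK ν 0 (Real.exp s) * GI ν 1 s
      - (-(Real.exp s * MK ν 1 (Real.exp s))) * GI ν 0 s) 0 s := by
    intro s
    refine (((b0 s).mul (a1 s)).sub ((b1 s).mul (a0 s))).congr_deriv ?_
    ring
  have hconst : ∀ y, MK ν 0 (Real.exp y) * GI ν 1 y
      - (-(Real.exp y * MK ν 1 (Real.exp y))) * GI ν 0 y = MK ν 0 (Real.exp s) * GI ν 1 s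
      - (-(Real.exp s * MK ν 1 (Real.exp s))) * GI ν 0 s := fun y =>
    is_const_of_deriv_eq_zero (fun y => (hw y).differentiableAt) (fun y => (hw y).deriv) y s
  obtain ⟨W, hWdef⟩ : ∃ W, W = MK ν 0 (Real.exp s) * GI ν 1 s
      - (-(Real.exp s * MK ν 1 (Real.exp s))) * GI ν 0 s := ⟨_, rfl⟩
  rw [← hWdef] at hconst
  have hW : 1 ≤ W := by
    have hl : Tendsto (fun y => Real.exp (-(Real.exp y / 2)) *
        (1 - Real.exp y / 2 / Real.Gamma (ν + 1))) atBot (𝓝 1) := by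
      have hc : Continuous (fun z : ℝ => Real.exp (-(z / 2)) *
        (1 - z / 2 / Real.Gamma (ν + 1))) := by fun_prop
      have := (hc.tendsto 0).comp Real.tendsto_exp_atBot
      simpa [Function.comp_def] using this
    refine le_of_tendsto hl ?_
    filter_upwards [eventually_le_atBot 0] with y hy
    have := wronskian_ge ν hν y (Real.exp_le_one_iff.2 hy)
    have := hconst y
    linarith
  refine g_bound ν (fun s => GI ν 0 s * MK ν 0 (Real.exp s))
    (fun s => GI ν 1 s * MK ν 0 (Real.exp s) + GI ν 0 s * (-(Real.exp s * MK ν 1 (Real.exp s))))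
    (fun s => 2 * (Real.exp s ^ 2 + ν ^ 2) * (GI ν 0 s * MK ν 0 (Real.exp s))
      + 2 * (GI ν 1 s * (-(Real.exp s * MK ν 1 (Real.exp s))))) W hW
    (fun s => mul_pos (GI_pos ν hν s) (MK_pos ν hν 0 _ (Real.exp_pos s)))
    (fun s => (a0 s).mul (b0 s)) ?_ ?_ s
  · intro y
    refine (((a1 y).mul (b0 y)).add ((a0 y).mul (b1 y))).congr_deriv ?_
    ring
  · intro y
    rw [← hconst y]
    ring
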